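/- arXiv:1908.01432 — 5 statements merged into one kernel-verified Lean document; each statement's English description precedes it below -/
import Mathlib

section
/- For integers n ≥ m ≥ 2, the double star S(n,m) satisfies γ_ri2(S(n,m)) + γ_ri2 of the complement of S(n,m) = |V(S(n,m))| + 1 = n + m + 3. -/
open scoped Classical

/-- A `k`-rainbow independent dominating function of `G`: values in `{0,...,k}`,
each nonzero colour class is independent, and every vertex of value `0` has,
for each `i ∈ {1,...,k}`, a neighbor of value `i`. -/
def IsKRiDF {V : Type*} (G : SimpleGraph V) (k : ℕ) (f : V → ℕ) : Prop :=
  (∀ v, f v ≤ k) ∧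
  (∀ i, 1 ≤ i → i ≤ k → ∀ u v, f u = i → f v = i → ¬ G.Adj u v) ∧
  (∀ v, f v = 0 → ∀ i, 1 ≤ i → i ≤ k → ∃ u, G.Adj v u ∧ f u = i)

/-- The weight of a labelling: the number of vertices with nonzero value. -/
noncomputable def riWeight {V : Type*} [Fintype V] (f : V → ℕ) : ℕ :=
  (Finset.univ.filter fun v => f v ≠ 0).card

/-- The `k`-rainbow independent domination number. -/
noncomputable def riNumber {V : Type*} [Fintype V] (G : SimpleGraph V) (k : ℕ) : ℕ :=
  sInf {w | ∃ f, IsKRiDF G k f ∧ riWeight f = w}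

/-- The star `S_m = K_{1,m}` on `Fin (m+1)` with centre `0`. -/
def starGraph (m : ℕ) : SimpleGraph (Fin (m + 1)) :=
  SimpleGraph.fromRel (fun a b => (a : ℕ) = 0 ∧ (b : ℕ) ≠ 0)

/-- The star `S_m` with one extra edge between the leaves `1` and `2`. -/
def starPlusGraph (m : ℕ) : SimpleGraph (Fin (m + 1)) :=
  SimpleGraph.fromRel (fun a b => ((a : ℕ) = 0 ∧ (b : ℕ) ≠ 0) ∨ ((a : ℕ) = 1 ∧ (b : ℕ) = 2))

/-- The double star `S(n,m)`: centres `0` (with leaves `2,...,n+1`) and `1`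
(with leaves `n+2,...,n+m+1`), joined by the bridge `01`. -/
def doubleStar (n m : ℕ) : SimpleGraph (Fin (n + m + 2)) :=
  SimpleGraph.fromRel (fun a b =>
    ((a : ℕ) = 0 ∧ (b : ℕ) = 1) ∨
    ((a : ℕ) = 0 ∧ 2 ≤ (b : ℕ) ∧ (b : ℕ) < n + 2) ∨
    ((a : ℕ) = 1 ∧ n + 2 ≤ (b : ℕ)))

theorem riNumber_eq_of_isKRiDF {V : Type*} [Fintype V] {G : SimpleGraph V} {k : ℕ} {f : V → ℕ}
    (hf : IsKRiDF G k f) (hmin : ∀ g, IsKRiDF G k g → riWeight f ≤ riWeight g) :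
    riNumber G k = riWeight f :=
  IsLeast.csInf_eq ⟨⟨f, hf, rfl⟩, by rintro _ ⟨g, hg, rfl⟩; exact hmin g hg⟩

theorem three_le_riWeight {V : Type*} [Fintype V] {f : V → ℕ} {a b c : V}
    (ha : f a ≠ 0) (hb : f b ≠ 0) (hc : f c ≠ 0) (hab : a ≠ b) (hac : a ≠ c) (hbc : b ≠ c) :
    3 ≤ riWeight f :=
  Finset.two_lt_card.2 ⟨a, by simpa, b, by simpa, c, by simpa, hab, hac, hbc⟩

theorem doubleStar_adj {n m : ℕ} {a b : Fin (n + m + 2)} :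
    (doubleStar n m).Adj a b ↔
      (a : ℕ) = 0 ∧ 1 ≤ (b : ℕ) ∧ (b : ℕ) < n + 2 ∨ (b : ℕ) = 0 ∧ 1 ≤ (a : ℕ) ∧ (a : ℕ) < n + 2 ∨
      (a : ℕ) = 1 ∧ n + 2 ≤ (b : ℕ) ∨ (b : ℕ) = 1 ∧ n + 2 ≤ (a : ℕ) := by
  simp only [doubleStar, SimpleGraph.fromRel_adj, ne_eq, Fin.ext_iff]
  omega

theorem doubleStar_compl_adj {n m : ℕ} {a b : Fin (n + m + 2)} :
    (doubleStar n m)ᶜ.Adj a b ↔ (a : ℕ) ≠ b ∧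
      ¬ ((a : ℕ) = 0 ∧ 1 ≤ (b : ℕ) ∧ (b : ℕ) < n + 2 ∨
        (b : ℕ) = 0 ∧ 1 ≤ (a : ℕ) ∧ (a : ℕ) < n + 2 ∨
        (a : ℕ) = 1 ∧ n + 2 ≤ (b : ℕ) ∨ (b : ℕ) = 1 ∧ n + 2 ≤ (a : ℕ)) := by
  rw [SimpleGraph.compl_adj, doubleStar_adj, ne_eq, Fin.ext_iff]

/-- Leaves of a double star have a single neighbour, so they all get a nonzero colour. -/
theorem doubleStar_leaf_ne_zero {n m : ℕ} {f : Fin (n + m + 2) → ℕ}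
    (hf : IsKRiDF (doubleStar n m) 2 f) {v : Fin (n + m + 2)} (hv : 2 ≤ (v : ℕ)) : f v ≠ 0 := by
  intro h0
  obtain ⟨a, ha, ha1⟩ := hf.2.2 v h0 1 le_rfl one_le_two
  obtain ⟨b, hb, hb2⟩ := hf.2.2 v h0 2 one_le_two le_rfl
  rw [doubleStar_adj] at ha hb
  obtain rfl : a = b := Fin.ext (by omega)
  omega

theorem riNumber_doubleStar {n m : ℕ} (hn : 2 ≤ n) (hm : 2 ≤ m) :
    riNumber (doubleStar n m) 2 = n + m := by
  let f : Fin (n + m + 2) → ℕ := fun v =>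
    if (v : ℕ) < 2 then 0 else if (v : ℕ) = 2 ∨ (v : ℕ) = n + 2 then 1 else 2
  have hf : IsKRiDF (doubleStar n m) 2 f := by
    refine ⟨fun v => ?_, fun i hi _ u v hu hv => ?_, fun v hv i hi hi2 => ?_⟩
    · dsimp only [f]; split_ifs <;> omega
    · rw [doubleStar_adj]
      dsimp only [f] at hu hv
      split_ifs at hu hv <;> omega
    · have hv2 : (v : ℕ) < 2 := by
        by_contra h
        simp only [f, if_neg h] at hv
        split_ifs at hv
      obtain h | h : (v : ℕ) = 0 ∨ (v : ℕ) = 1 := by omega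
      · refine ⟨⟨1 + i, by omega⟩, doubleStar_adj.2 (by dsimp only; omega), ?_⟩
        dsimp only [f]; split_ifs <;> omega
      · refine ⟨⟨n + 1 + i, by omega⟩, doubleStar_adj.2 (by dsimp only; omega), ?_⟩
        dsimp only [f]; split_ifs <;> omega
  let c₀ : Fin (n + m + 2) := ⟨0, by omega⟩
  let c₁ : Fin (n + m + 2) := ⟨1, by omega⟩
  have hcard : ({c₀, c₁}ᶜ : Finset (Fin (n + m + 2))).card = n + m := by
    rw [Finset.card_compl, Finset.card_pair (by simp [c₀, c₁]), Fintype.card_fin]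
    omega
  have hmem {v : Fin (n + m + 2)} : v ∈ ({c₀, c₁}ᶜ : Finset _) ↔ 2 ≤ (v : ℕ) := by
    simp only [Finset.mem_compl, Finset.mem_insert, Finset.mem_singleton, Fin.ext_iff, c₀, c₁]
    omega
  have hweight : riWeight f = n + m := by
    refine (congrArg Finset.card (Finset.ext fun v => ?_)).trans hcard
    rw [Finset.mem_filter_univ, hmem]
    dsimp only [f]
    split_ifs <;> omega
  rw [riNumber_eq_of_isKRiDF hf, hweight]
  intro g hg
  refine (hweight.trans hcard.symm).trans_le (Finset.card_le_card fun v hv => ?_)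
  rw [Finset.mem_filter_univ]
  exact doubleStar_leaf_ne_zero hg (hmem.1 hv)

/-- If a vertex `c` of nonzero colour has two non-neighbours, at least three vertices are
coloured. -/
theorem IsKRiDF.three_le_riWeight_of_not_adj {V : Type*} [Fintype V] {G : SimpleGraph V}
    {f : V → ℕ} (hf : IsKRiDF G 2 f) {c a b : V} (hc : f c ≠ 0) (hca : c ≠ a) (hcb : c ≠ b)
    (hab : a ≠ b) (ha : ¬ G.Adj a c) (hb : ¬ G.Adj b c) : 3 ≤ riWeight f := by
  have key {x : V} (hx : ¬ G.Adj x c) (hx0 : f x = 0) : 3 ≤ riWeight f := by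
    obtain ⟨u, hu, hu1⟩ := hf.2.2 x hx0 1 le_rfl one_le_two
    obtain ⟨v, hv, hv2⟩ := hf.2.2 x hx0 2 one_le_two le_rfl
    refine three_le_riWeight (a := c) (b := u) (c := v) hc (by omega) (by omega) ?_ ?_ ?_
    · rintro rfl; exact hx hu
    · rintro rfl; exact hx hv
    · rintro rfl; omega
  by_cases ha0 : f a = 0
  · exact key ha ha0
  by_cases hb0 : f b = 0
  · exact key hb hb0
  exact three_le_riWeight hc ha0 hb0 hca hcb hab

theorem three_le_riWeight_doubleStar_compl {n m : ℕ} (hn : 2 ≤ n) (hm : 2 ≤ m)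
    {f : Fin (n + m + 2) → ℕ} (hf : IsKRiDF (doubleStar n m)ᶜ 2 f) : 3 ≤ riWeight f := by
  by_cases h0 : f ⟨0, by omega⟩ = 0
  · by_cases h1 : f ⟨1, by omega⟩ = 0
    · obtain ⟨a, ha, ha1⟩ := hf.2.2 _ h0 1 le_rfl one_le_two
      obtain ⟨b, hb, hb2⟩ := hf.2.2 _ h0 2 one_le_two le_rfl
      obtain ⟨c, hc, hc1⟩ := hf.2.2 _ h1 1 le_rfl one_le_two
      rw [doubleStar_compl_adj] at ha hb hc
      dsimp only at ha hb hc
      refine three_le_riWeight (a := a) (b := b) (c := c) (by omega) (by omega) (by omega) ?_ ?_ ?_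
      · rintro rfl; omega
      · rintro rfl; omega
      · rintro rfl; omega
    · refine hf.three_le_riWeight_of_not_adj h1
        (a := ⟨n + 2, by omega⟩) (b := ⟨n + 3, by omega⟩)
        (by simp [Fin.ext_iff]) (by simp [Fin.ext_iff]) (by simp)
        (doubleStar_compl_adj.not.2 (by dsimp only; omega))
        (doubleStar_compl_adj.not.2 (by dsimp only; omega))
  · refine hf.three_le_riWeight_of_not_adj h0
      (a := ⟨2, by omega⟩) (b := ⟨3, by omega⟩)
      (by simp [Fin.ext_iff]) (by simp [Fin.ext_iff]) (by simp)
      (doubleStar_compl_adj.not.2 (by dsimp only; omega))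
      (doubleStar_compl_adj.not.2 (by dsimp only; omega))

theorem riNumber_doubleStar_compl {n m : ℕ} (hn : 2 ≤ n) (hm : 2 ≤ m) :
    riNumber (doubleStar n m)ᶜ 2 = 3 := by
  let f : Fin (n + m + 2) → ℕ := fun v => if (v : ℕ) < 2 then 1 else if (v : ℕ) = 2 then 2 else 0
  have hf : IsKRiDF (doubleStar n m)ᶜ 2 f := by
    refine ⟨fun v => ?_, fun i hi _ u v hu hv => ?_, fun v hv i hi hi2 => ?_⟩
    · dsimp only [f]; split_ifs <;> omega
    · rw [doubleStar_compl_adj]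
      dsimp only [f] at hu hv
      split_ifs at hu hv <;> omega
    · have hv2 : 3 ≤ (v : ℕ) := by
        dsimp only [f] at hv
        split_ifs at hv
        omega
      obtain rfl | rfl : i = 1 ∨ i = 2 := by omega
      · by_cases h : (v : ℕ) < n + 2
        · exact ⟨⟨1, by omega⟩, doubleStar_compl_adj.2 (by dsimp only; omega), by simp [f]⟩
        · exact ⟨⟨0, by omega⟩, doubleStar_compl_adj.2 (by dsimp only; omega), by simp [f]⟩
      · exact ⟨⟨2, by omega⟩, doubleStar_compl_adj.2 (by dsimp only; omega), by simp [f]⟩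
  have hle : riWeight f ≤ 3 := by
    refine (Finset.card_le_card (t := {⟨0, by omega⟩, ⟨1, by omega⟩, ⟨2, by omega⟩}) ?_).trans
      Finset.card_le_three
    intro v hv
    rw [Finset.mem_filter_univ] at hv
    simp only [Finset.mem_insert, Finset.mem_singleton, Fin.ext_iff]
    dsimp only [f] at hv
    split_ifs at hv <;> omega
  rw [riNumber_eq_of_isKRiDF hf fun g hg =>
    hle.trans (three_le_riWeight_doubleStar_compl hn hm hg)]
  exact hle.antisymm (three_le_riWeight_doubleStar_compl hn hm hf)

theorem stmt_13 (n m : ℕ) (hm : 2 ≤ m) (hnm : m ≤ n) :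
    riNumber (doubleStar n m) 2 + riNumber (doubleStar n m)ᶜ 2
        = Fintype.card (Fin (n + m + 2)) + 1 ∧
    riNumber (doubleStar n m) 2 + riNumber (doubleStar n m)ᶜ 2 = n + m + 3 := by
  rw [riNumber_doubleStar (hm.trans hnm) hm, riNumber_doubleStar_compl (hm.trans hnm) hm,
    Fintype.card_fin]
  omega
end

section
/- Let G be a connected graph of order n ≥ 3 with γ_ri2(G) = n − 1. If x is a vertex of G of degree at least 3, then every vertex of G of degree at least 2 other than x is adjacent to x. -/
open scoped Classical

/-- An independent set disjoint from `B` extends to one that dominates everything outside `B`. -/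
theorem exists_indepSet_dominating {V : Type*} [Finite V] (G : SimpleGraph V) {A B : Set V}
    (hA : G.IsIndepSet A) (hAB : Disjoint A B) :
    ∃ A', A ⊆ A' ∧ G.IsIndepSet A' ∧ Disjoint A' B ∧
      ∀ v, v ∉ A' → v ∉ B → ∃ u ∈ A', G.Adj v u := by
  obtain ⟨A', hle, hmax⟩ := Finite.exists_le_maximal
    (p := fun S : Set V => G.IsIndepSet S ∧ Disjoint S B) ⟨hA, hAB⟩
  refine ⟨A', hle, hmax.prop.1, hmax.prop.2, fun v hv hvB => ?_⟩
  by_contra! hno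
  refine hv (hmax.le_of_ge ⟨?_, ?_⟩ (Set.subset_insert v A') (Set.mem_insert v A'))
  · exact hmax.prop.1.insert fun u hu _ => ⟨hno u hu, fun h => hno u hu h.symm⟩
  · exact Set.disjoint_insert_left.2 ⟨hvB, hmax.prop.2⟩

/-- If two vertices each have a neighbor in both of two disjoint independent sets, then the
2-rainbow independent domination number is at most the order minus two. -/
theorem riNumber_two_add_two_le {V : Type*} [Fintype V] (G : SimpleGraph V) {A B : Set V}
    (hA : G.IsIndepSet A) (hB : G.IsIndepSet B) (hAB : Disjoint A B) {p q : V} (hpq : p ≠ q)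
    (hpA : ∃ u ∈ A, G.Adj p u) (hpB : ∃ u ∈ B, G.Adj p u)
    (hqA : ∃ u ∈ A, G.Adj q u) (hqB : ∃ u ∈ B, G.Adj q u) :
    riNumber G 2 + 2 ≤ Fintype.card V := by
  obtain ⟨A', hAA', hA', hA'B, hdomA⟩ := exists_indepSet_dominating G hA hAB
  obtain ⟨B', hBB', hB', hB'A', hdomB⟩ := exists_indepSet_dominating G hB hA'B.symm
  have not_mem {S T : Set V} (hST : S ⊆ T) (hT : G.IsIndepSet T) {v : V}
      (hv : ∃ u ∈ S, G.Adj v u) : v ∉ T := by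
    obtain ⟨u, hu, hvu⟩ := hv
    exact fun hvT => hT hvT (hST hu) hvu.ne hvu
  let f : V → ℕ := fun v => if v ∈ A' then 1 else if v ∈ B' then 2 else 0
  have f_one {v : V} : f v = 1 ↔ v ∈ A' := by grind
  have f_two {v : V} : f v = 2 ↔ v ∈ B' := by
    have := fun h : v ∈ B' => Set.disjoint_left.1 hB'A' h
    grind
  have f_zero {v : V} : f v = 0 ↔ v ∉ A' ∧ v ∉ B' := by grind
  have hf : IsKRiDF G 2 f := by
    refine ⟨fun v => by grind, fun i h1 h2 u v hu hv huv => ?_, fun v hv i h1 h2 => ?_⟩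
    · obtain rfl | rfl : i = 1 ∨ i = 2 := by omega
      · exact hA' (f_one.1 hu) (f_one.1 hv) huv.ne huv
      · exact hB' (f_two.1 hu) (f_two.1 hv) huv.ne huv
    · obtain ⟨hvA, hvB⟩ := f_zero.1 hv
      obtain rfl | rfl : i = 1 ∨ i = 2 := by omega
      · obtain ⟨u, hu, hvu⟩ := hdomA v hvA fun h => hvB (hBB' h)
        exact ⟨u, hvu, f_one.2 hu⟩
      · obtain ⟨u, hu, hvu⟩ := hdomB v hvB hvA
        exact ⟨u, hvu, f_two.2 hu⟩
  have hp : f p = 0 := f_zero.2 ⟨not_mem hAA' hA' hpA, not_mem hBB' hB' hpB⟩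
  have hq : f q = 0 := f_zero.2 ⟨not_mem hAA' hA' hqA, not_mem hBB' hB' hqB⟩
  have hle : riNumber G 2 ≤ riWeight f := Nat.sInf_le ⟨f, hf, rfl⟩
  have hweight : riWeight f + 2 ≤ Fintype.card V := by
    have hsub : ({p, q} : Finset V) ⊆ Finset.univ.filter fun v => ¬ f v ≠ 0 := by
      simp [Finset.insert_subset_iff, hp, hq]
    have hcard := Finset.card_le_card hsub
    rw [Finset.card_pair hpq] at hcard
    have := Finset.card_filter_add_card_filter_not (s := (Finset.univ : Finset V))
      (fun v => f v ≠ 0)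
    rw [Finset.card_univ] at this
    unfold riWeight
    omega
  omega

/-- Version of `riNumber_two_add_two_le` for two sets of at most two vertices. -/
theorem riNumber_two_add_two_le_of_adj {V : Type*} [Fintype V] (G : SimpleGraph V)
    {x y a b c d : V} (hxy : x ≠ y) (hxa : G.Adj x a) (hxb : G.Adj x b)
    (hyc : G.Adj y c) (hyd : G.Adj y d) (hac : ¬ G.Adj a c) (hbd : ¬ G.Adj b d)
    (hab : a ≠ b) (had : a ≠ d) (hcb : c ≠ b) (hcd : c ≠ d) :
    riNumber G 2 + 2 ≤ Fintype.card V := by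
  have indep {u v : V} (h : ¬ G.Adj u v) : G.IsIndepSet {u, v} :=
    Set.pairwise_pair.2 fun _ => ⟨h, fun h' => h h'.symm⟩
  refine riNumber_two_add_two_le G (indep hac) (indep hbd) ?_ hxy ⟨a, by simp, hxa⟩
    ⟨b, by simp, hxb⟩ ⟨c, by simp, hyc⟩ ⟨d, by simp, hyd⟩
  simp [Set.disjoint_left, hab, had, hcb, hcd]

theorem stmt_14 {V : Type*} [Fintype V] (G : SimpleGraph V) (n : ℕ)
    (hcard : Fintype.card V = n) (hn : 3 ≤ n) (hconn : G.Connected)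
    (hri : riNumber G 2 = n - 1)
    (x : V) (hx : 3 ≤ G.degree x) :
    ∀ y : V, y ≠ x → 2 ≤ G.degree y → G.Adj y x := by
  intro y hyx hy
  by_contra hadj
  have hlt : ¬ riNumber G 2 + 2 ≤ Fintype.card V := by omega
  have no_c4 {u v s t : V} (hus : G.Adj u s) (hut : G.Adj u t) (hvs : G.Adj v s)
      (hvt : G.Adj v t) (huv : u ≠ v) : s = t := by
    by_contra hst
    exact hlt (riNumber_two_add_two_le_of_adj G huv hus hut hvs hvt (by simp) (by simp)
      hst hst hst hst)
  have no_config {a b c d : V} (hxa : G.Adj x a) (hxb : G.Adj x b)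
      (hyc : G.Adj y c) (hyd : G.Adj y d) (hac : ¬ G.Adj a c) (hbd : ¬ G.Adj b d)
      (hab : a ≠ b) (had : a ≠ d) (hcb : c ≠ b) (hcd : c ≠ d) : False :=
    hlt (riNumber_two_add_two_le_of_adj G hyx.symm hxa hxb hyc hyd hac hbd hab had hcb hcd)
  rw [← SimpleGraph.card_neighborFinset_eq_degree] at hx hy
  obtain ⟨a, ha, b, hb, e, he, hab, hae, hbe⟩ := Finset.two_lt_card.1 hx
  obtain ⟨c, hc, d, hd, hcd⟩ := Finset.one_lt_card.1 hy
  simp only [SimpleGraph.mem_neighborFinset] at ha hb he hc hd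
  have nbr {c u v : V} (hyc : G.Adj y c) (hu : G.Adj x u) (hv : G.Adj x v)
      (huv : u ≠ v) : ¬ G.Adj u c ∨ ¬ G.Adj v c := by
    by_contra! h
    exact huv (no_c4 hu hv h.1.symm h.2.symm fun hxc => hadj (hxc ▸ hyc))
  -- A common neighbor of `x` and `y` takes one colour on its own.
  have no_common {c d : V} (hc : G.Adj y c) (hd : G.Adj y d) (hcd : c ≠ d) : ¬ G.Adj x c := by
    intro hxc
    have hxd : ¬ G.Adj x d := fun hxd => hcd (no_c4 hxc hxd hc hd hyx.symm)
    have key {u v : V} (hu : G.Adj x u) (hv : G.Adj x v) (huv : u ≠ v) (huc : u ≠ c)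
        (hvc : v ≠ c) : False := by
      rcases nbr hd hu hv huv with h | h
      · exact no_config hxc hu hc hd (G.irrefl) h huc.symm hcd huc.symm hcd
      · exact no_config hxc hv hc hd (G.irrefl) h hvc.symm hcd hvc.symm hcd
    by_cases hac : a = c
    · exact key hb he hbe (hac ▸ hab.symm) (hac ▸ hae.symm)
    by_cases hbc : b = c
    · exact key ha he hae hac (hbc ▸ hbe.symm)
    exact key ha hb hab hac hbc
  have hxc := no_common hc hd hcd
  have hxd := no_common hd hc hcd.symm
  have key {u v : V} (hu : G.Adj x u) (hv : G.Adj x v) (huv : u ≠ v) (huc : ¬ G.Adj u c)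
      (hvd : ¬ G.Adj v d) : False :=
    no_config hu hv hc hd huc hvd huv (fun h => hxd (h ▸ hu)) (fun h => hxc (h ▸ hv)) hcd
  have adj_or {u v : V} (hu : G.Adj x u) (hv : G.Adj x v) (huv : u ≠ v) :
      G.Adj u c ∨ G.Adj v c := by
    by_contra! h
    rcases nbr hd hu hv huv with hud | hvd
    · exact key hv hu huv.symm h.2 hud
    · exact key hu hv huv h.1 hvd
  rcases adj_or ha hb hab with hac | hbc
  · have hbc := (nbr hc ha hb hab).resolve_left (not_not_intro hac)
    have hec := (nbr hc ha he hae).resolve_left (not_not_intro hac)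
    exact (adj_or hb he hbe).elim hbc hec
  · have hac := (nbr hc ha hb hab).resolve_right (not_not_intro hbc)
    have hec := (nbr hc hb he hbe).resolve_left (not_not_intro hbc)
    exact (adj_or ha he hae).elim hac hec
end

section
/- Let G be a connected graph of order n ≥ 3 with γ_ri2(G) = n − 1. Then G contains at most one vertex of degree at least 3. -/
open scoped Classical

theorem isIndepSet_insert {V : Type*} {G : SimpleGraph V} {S : Set V} {v : V}
    (hS : G.IsIndepSet S) (hv : ∀ u ∈ S, ¬ G.Adj v u) : G.IsIndepSet (insert v S) :=
  Set.pairwise_insert.2 ⟨hS, fun u hu _ => ⟨hv u hu, fun h => hv u hu h.symm⟩⟩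

/-- Two disjoint independent sets extend to the colour classes of a 2-rainbow independent
dominating function. -/
theorem exists_isKRiDF_two_extending {V : Type*} [Fintype V] (G : SimpleGraph V) (A B : Set V)
    (hA : G.IsIndepSet A) (hB : G.IsIndepSet B) (hAB : Disjoint A B) :
    ∃ f : V → ℕ, IsKRiDF G 2 f ∧ (∀ a ∈ A, f a = 1) ∧ (∀ b ∈ B, f b = 2) := by
  obtain ⟨⟨S, T⟩, ⟨hAS, hBT⟩, hmax⟩ := Finite.exists_le_maximal
    (p := fun p : Set V × Set V => G.IsIndepSet p.1 ∧ G.IsIndepSet p.2 ∧ Disjoint p.1 p.2)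
    (a := (A, B)) ⟨hA, hB, hAB⟩
  obtain ⟨hS, hT, hST⟩ := hmax.prop
  simp only at hAS hBT hS hT hST
  have hdisj : ∀ v ∈ S, v ∉ T := fun v hvS hvT => Set.disjoint_left.1 hST hvS hvT
  have hdomS : ∀ v, v ∉ S → v ∉ T → ∃ u ∈ S, G.Adj v u := by
    intro v hvS hvT
    by_contra! hv
    have hle := hmax.le_of_ge (y := (insert v S, T))
      ⟨isIndepSet_insert hS hv, hT, Set.disjoint_insert_left.2 ⟨hvT, hST⟩⟩
      ⟨Set.subset_insert v S, le_rfl⟩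
    exact hvS (hle.1 (Set.mem_insert v S))
  have hdomT : ∀ v, v ∉ S → v ∉ T → ∃ u ∈ T, G.Adj v u := by
    intro v hvS hvT
    by_contra! hv
    have hle := hmax.le_of_ge (y := (S, insert v T))
      ⟨hS, isIndepSet_insert hT hv, Set.disjoint_insert_right.2 ⟨hvS, hST⟩⟩
      ⟨le_rfl, Set.subset_insert v T⟩
    exact hvT (hle.2 (Set.mem_insert v T))
  let f : V → ℕ := fun v => if v ∈ S then 1 else if v ∈ T then 2 else 0
  have hf1 : ∀ v, f v = 1 ↔ v ∈ S := by intro v; simp only [f]; split_ifs <;> simp_all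
  have hf2 : ∀ v, f v = 2 ↔ v ∈ T := by intro v; simp only [f]; split_ifs <;> simp_all
  refine ⟨f, ⟨fun v => ?_, fun i hi hi' u v hu hv huv => ?_, fun v hv i hi hi' => ?_⟩,
    fun a ha => (hf1 a).2 (hAS ha), fun b hb => (hf2 b).2 (hBT hb)⟩
  · simp only [f]; split_ifs <;> simp
  · interval_cases i
    · exact hS ((hf1 u).1 hu) ((hf1 v).1 hv) huv.ne huv
    · exact hT ((hf2 u).1 hu) ((hf2 v).1 hv) huv.ne huv
  · have hvS : v ∉ S := fun h => by have := (hf1 v).2 h; omega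
    have hvT : v ∉ T := fun h => by have := (hf2 v).2 h; omega
    interval_cases i
    · obtain ⟨u, hu, huv⟩ := hdomS v hvS hvT
      exact ⟨u, huv, (hf1 u).2 hu⟩
    · obtain ⟨u, hu, huv⟩ := hdomT v hvS hvT
      exact ⟨u, huv, (hf2 u).2 hu⟩

theorem riNumber_add_two_le_card {V : Type*} [Fintype V] {G : SimpleGraph V} {f : V → ℕ} {k : ℕ}
    (hf : IsKRiDF G k f) {u w : V} (huw : u ≠ w) (hu : f u = 0) (hw : f w = 0) :
    riNumber G k + 2 ≤ Fintype.card V := by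
  have hle : riNumber G k ≤ riWeight f := Nat.sInf_le ⟨f, hf, rfl⟩
  have hsub : ({u, w} : Finset V) ⊆ Finset.univ.filter fun v => ¬ f v ≠ 0 := by
    intro v; simp only [Finset.mem_insert, Finset.mem_singleton]
    rintro (rfl | rfl) <;> simpa
  have hcard := Finset.card_le_card hsub
  rw [Finset.card_pair huw] at hcard
  have hadd := Finset.card_filter_add_card_filter_not (s := (Finset.univ : Finset V))
    (fun v => f v ≠ 0)
  rw [Finset.card_univ] at hadd
  unfold riWeight at hle
  omega

/-- If `a, c` can be coloured `1` and `b, d` can be coloured `2`, so that `u` sees `a, b` and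
`w` sees `c, d`, then both `u` and `w` get value `0`. -/
theorem riNumber_two_add_two_le_card {V : Type*} [Fintype V] {G : SimpleGraph V}
    {u w a b c d : V} (huw : u ≠ w) (hua : G.Adj u a) (hub : G.Adj u b) (hwc : G.Adj w c)
    (hwd : G.Adj w d) (hab : a ≠ b) (had : a ≠ d) (hcb : c ≠ b) (hcd : c ≠ d)
    (hac : ¬ G.Adj a c) (hbd : ¬ G.Adj b d) : riNumber G 2 + 2 ≤ Fintype.card V := by
  have hpair : ∀ {s t : V}, ¬ G.Adj s t → G.IsIndepSet {s, t} := fun {s t} hst =>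
    Set.pairwise_pair.2 fun _ => ⟨hst, fun hts => hst hts.symm⟩
  obtain ⟨f, hf, h1, h2⟩ := exists_isKRiDF_two_extending G {a, c} {b, d} (hpair hac) (hpair hbd)
    (by simp [hab.symm, had.symm, hcb.symm, hcd.symm])
  have hzero : ∀ {v s t : V}, G.Adj v s → G.Adj v t → f s = 1 → f t = 2 → f v = 0 := by
    intro v s t hvs hvt hs ht
    have hle := hf.1 v
    have hv1 : f v ≠ 1 := fun h => hf.2.1 1 (by simp) (by simp) v s h hs hvs
    have hv2 : f v ≠ 2 := fun h => hf.2.1 2 (by simp) (by simp) v t h ht hvt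
    omega
  exact riNumber_add_two_le_card hf huw
    (hzero hua hub (h1 a (by simp)) (h2 b (by simp)))
    (hzero hwc hwd (h1 c (by simp)) (h2 d (by simp)))

/-- A vertex of degree at least `3` has two distinct neighbours other than a given vertex. -/
theorem exists_two_adj_ne {V : Type*} [Fintype V] {G : SimpleGraph V} {x : V}
    (hx : 3 ≤ G.degree x) (z : V) :
    ∃ a b, G.Adj x a ∧ G.Adj x b ∧ a ≠ b ∧ a ≠ z ∧ b ≠ z := by
  have hcard : 1 < ((G.neighborFinset x).erase z).card := by
    have := Finset.pred_card_le_card_erase (s := G.neighborFinset x) (a := z)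
    rw [G.card_neighborFinset_eq_degree] at this
    omega
  obtain ⟨a, ha, b, hb, hab⟩ := Finset.one_lt_card.1 hcard
  simp only [Finset.mem_erase, SimpleGraph.mem_neighborFinset] at ha hb
  exact ⟨a, b, ha.2, hb.2, hab, ha.1, hb.1⟩

theorem stmt_15 {V : Type*} [Fintype V] (G : SimpleGraph V) (n : ℕ)
    (hcard : Fintype.card V = n) (hn : 3 ≤ n) (hconn : G.Connected)
    (hri : riNumber G 2 = n - 1) :
    ∀ x y : V, 3 ≤ G.degree x → 3 ≤ G.degree y → x = y := by
  intro x y hx hy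
  by_contra hxy
  have hlt : ¬ riNumber G 2 + 2 ≤ Fintype.card V := by omega
  have hC4 : ∀ {u w a b : V}, u ≠ w → G.Adj u a → G.Adj u b → G.Adj w a → G.Adj w b → a = b := by
    intro u w a b huw hua hub hwa hwb
    by_contra hab
    exact hlt (riNumber_two_add_two_le_card huw hua hub hwa hwb hab hab hab hab
      (G.irrefl) (G.irrefl))
  have key : ∀ {a b c d : V}, G.Adj x a → G.Adj x b → G.Adj y c → G.Adj y d → a ≠ b → a ≠ d →
      c ≠ b → c ≠ d → G.Adj a c ∨ G.Adj b d := by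
    intro a b c d hxa hxb hyc hyd hab had hcb hcd
    by_contra! h
    exact hlt (riNumber_two_add_two_le_card hxy hxa hxb hyc hyd hab had hcb hcd h.1 h.2)
  by_cases hcommon : ∃ a, G.Adj x a ∧ G.Adj y a
  · obtain ⟨a, hxa, hya⟩ := hcommon
    have hjoin : ∀ {b d : V}, G.Adj x b → G.Adj y d → a ≠ b → a ≠ d → G.Adj b d :=
      fun hxb hyd hab had => (key hxa hxb hya hyd hab had hab had).resolve_left G.irrefl
    obtain ⟨b, b', hxb, hxb', hbb', hba, hba'⟩ := exists_two_adj_ne hx a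
    by_cases hadj : G.Adj x y
    · obtain ⟨b, hxb, hba, hby⟩ : ∃ b, G.Adj x b ∧ b ≠ a ∧ b ≠ y := by
        by_cases h : b = y
        · exact ⟨b', hxb', hba', fun h' => hbb' (h.trans h'.symm)⟩
        · exact ⟨b, hxb, hba, h⟩
      obtain ⟨d, d', hyd, hyd', hdd', hda, hda'⟩ := exists_two_adj_ne hy a
      obtain ⟨d, hyd, hda, hdx⟩ : ∃ d, G.Adj y d ∧ d ≠ a ∧ d ≠ x := by
        by_cases h : d = x
        · exact ⟨d', hyd', hda', fun h' => hdd' (h.trans h'.symm)⟩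
        · exact ⟨d, hyd, hda, h⟩
      exact hby (hC4 hdx.symm hxb hadj (hjoin hxb hyd hba.symm hda.symm).symm hyd.symm)
    · obtain ⟨d, _, hyd, _, _, hda, _⟩ := exists_two_adj_ne hy a
      have hdx : x ≠ d := by rintro rfl; exact hadj hyd.symm
      exact hbb' (hC4 hdx hxb hxb' (hjoin hxb hyd hba.symm hda.symm).symm
        (hjoin hxb' hyd hba'.symm hda.symm).symm)
  · push Not at hcommon
    obtain ⟨a, b, hxa, hxb, hab, hay, hby⟩ := exists_two_adj_ne hx y
    obtain ⟨c, d, hyc, hyd, hcd, hcx, hdx⟩ := exists_two_adj_ne hy x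
    have hne : ∀ {s t : V}, G.Adj x s → G.Adj y t → s ≠ t := by
      rintro s _ hs ht rfl; exact hcommon s hs ht
    have ha : ¬ (G.Adj a c ∧ G.Adj a d) :=
      fun h => hay (hC4 hcd h.1.symm hyc.symm h.2.symm hyd.symm)
    have hb : ¬ (G.Adj b c ∧ G.Adj b d) :=
      fun h => hby (hC4 hcd h.1.symm hyc.symm h.2.symm hyd.symm)
    have hc : ¬ (G.Adj a c ∧ G.Adj b c) :=
      fun h => hab (hC4 hcx.symm hxa hxb h.1.symm h.2.symm)
    have hd : ¬ (G.Adj a d ∧ G.Adj b d) :=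
      fun h => hab (hC4 hdx.symm hxa hxb h.1.symm h.2.symm)
    have h := key hxa hxb hyc hyd hab (hne hxa hyd) (hne hxb hyc).symm hcd
    have h' := key hxa hxb hyd hyc hab (hne hxa hyc) (hne hxb hyd).symm hcd.symm
    tauto
end

section
/- Let G be a graph of order n with γ_ri2(G) = n − 1. Then any two distinct vertices of G have at most one common neighbor in G (equivalently, G contains no 4-cycle as a subgraph). -/
open scoped Classical

/-- In a finite graph, `u ∈ W` lies in an independent subset of `W` dominating the rest of `W`. -/
theorem exists_isIndepSet_dominating {V : Type*} [Finite V] (G : SimpleGraph V) {W : Set V}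
    {u : V} (hu : u ∈ W) :
    ∃ A ⊆ W, u ∈ A ∧ G.IsIndepSet A ∧ ∀ w ∈ W, w ∉ A → ∃ x ∈ A, G.Adj w x := by
  have hsingle : {u} ⊆ W ∧ G.IsIndepSet {u} :=
    ⟨Set.singleton_subset_iff.2 hu, Set.pairwise_singleton _ _⟩
  obtain ⟨A, huA, hA⟩ :=
    (Set.toFinite {A : Set V | A ⊆ W ∧ G.IsIndepSet A}).exists_le_maximal hsingle
  refine ⟨A, hA.prop.1, huA rfl, hA.prop.2, fun w hw hwA => ?_⟩
  by_contra! hno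
  have hins : insert w A ⊆ W ∧ G.IsIndepSet (insert w A) := by
    refine ⟨Set.insert_subset hw hA.prop.1, hA.prop.2.insert fun x hx _ => ?_⟩
    exact ⟨hno x hx, fun h => hno x hx h.symm⟩
  exact hwA (hA.le_of_ge hins (Set.subset_insert w A) (Set.mem_insert w A))

/-- Distinct vertices `u`, `v` extend to a 2RiDF that vanishes on all their common neighbors. -/
theorem exists_isKRiDF_two_eq_zero_on_commonNeighbors {V : Type*} [Finite V]
    (G : SimpleGraph V) {u v : V} (huv : u ≠ v) :
    ∃ f, IsKRiDF G 2 f ∧ ∀ a, G.Adj u a → G.Adj v a → f a = 0 := by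
  obtain ⟨A, hAW, huA, hA, hAdom⟩ := exists_isIndepSet_dominating G (W := {v}ᶜ) huv
  have hvA : v ∈ Aᶜ := fun h => hAW h rfl
  obtain ⟨B, hBW, hvB, hB, hBdom⟩ := exists_isIndepSet_dominating G hvA
  let f : V → ℕ := fun x => if x ∈ A then 1 else if x ∈ B then 2 else 0
  have h1 : ∀ x, f x = 1 ↔ x ∈ A := by intro x; simp only [f]; split_ifs <;> simp_all
  have h2 : ∀ x, f x = 2 ↔ x ∈ B := by
    intro x
    have := @hBW x
    simp only [f]; split_ifs <;> simp_all
  have h0 : ∀ x, f x = 0 ↔ x ∉ A ∧ x ∉ B := by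
    intro x; simp only [f]; split_ifs <;> simp_all
  refine ⟨f, ⟨fun x => ?_, fun i hi hi2 x y hx hy hxy => ?_, fun x hx i hi hi2 => ?_⟩,
    fun a hua hva => (h0 a).2 ⟨fun ha => hA huA ha hua.ne hua, fun hb => hB hvB hb hva.ne hva⟩⟩
  · simp only [f]; split_ifs <;> simp
  · obtain rfl | rfl : i = 1 ∨ i = 2 := by omega
    · exact hA ((h1 x).1 hx) ((h1 y).1 hy) hxy.ne hxy
    · exact hB ((h2 x).1 hx) ((h2 y).1 hy) hxy.ne hxy
  · obtain ⟨hxA, hxB⟩ := (h0 x).1 hx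
    obtain rfl | rfl : i = 1 ∨ i = 2 := by omega
    · obtain ⟨y, hy, hxy⟩ := hAdom x (fun h => hxB (h ▸ hvB)) hxA
      exact ⟨y, hxy, (h1 y).2 hy⟩
    · obtain ⟨y, hy, hxy⟩ := hBdom x hxA hxB
      exact ⟨y, hxy, (h2 y).2 hy⟩

theorem stmt_17 {V : Type*} [Fintype V] (G : SimpleGraph V) (n : ℕ)
    (hcard : Fintype.card V = n) (hri : riNumber G 2 = n - 1) :
    ∀ u v : V, u ≠ v → (G.neighborFinset u ∩ G.neighborFinset v).card ≤ 1 := by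
  intro u v huv
  obtain ⟨f, hf, hzero⟩ := exists_isKRiDF_two_eq_zero_on_commonNeighbors G huv
  have hle : riNumber G 2 ≤ riWeight f := Nat.sInf_le ⟨f, hf, rfl⟩
  have hsub : G.neighborFinset u ∩ G.neighborFinset v ⊆ Finset.univ.filter fun x => ¬ f x ≠ 0 := by
    intro a ha
    simp only [Finset.mem_inter, SimpleGraph.mem_neighborFinset] at ha
    simpa using hzero a ha.1 ha.2
  have hcommon := Finset.card_le_card hsub
  have hsplit : riWeight f + (Finset.univ.filter fun x => ¬ f x ≠ 0).card = Fintype.card V :=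
    Finset.card_filter_add_card_filter_not _
  omega
end

section
/- For any graph G of order n, γ_ri2(G) = n if and only if every connected component of G is isomorphic to K_1 or K_2 (equivalently, every vertex of G has degree at most 1). Moreover, if n ≥ 3 and γ_ri2(G) = n, then γ_ri2 of the complement of G equals 2. -/
open scoped Classical

section RainbowIndependentDomination

variable {V : Type*} [Fintype V] {G : SimpleGraph V} {k : ℕ} {f : V → ℕ}

lemma riWeight_le_card (f : V → ℕ) : riWeight f ≤ Fintype.card V :=
  Finset.card_le_univ _

lemma riWeight_eq_card_iff : riWeight f = Fintype.card V ↔ ∀ v, f v ≠ 0 := by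
  simp [riWeight, Finset.card_eq_iff_eq_univ, Finset.filter_eq_self]

/-- Every partial labelling with independent colour classes extends to a `k`-rainbow
independent dominating function. -/
lemma exists_isKRiDF_extending (G : SimpleGraph V) (k : ℕ) (f : V → ℕ)
    (hf : ∀ v, f v ≤ k)
    (hind : ∀ i, 1 ≤ i → i ≤ k → ∀ u v, f u = i → f v = i → ¬ G.Adj u v) :
    ∃ g, IsKRiDF G k g ∧ ∀ v, f v ≠ 0 → g v = f v := by
  by_cases hdom : ∀ v, f v = 0 → ∀ i, 1 ≤ i → i ≤ k → ∃ u, G.Adj v u ∧ f u = i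
  · exact ⟨f, ⟨hf, hind, hdom⟩, fun _ _ => rfl⟩
  · push Not at hdom
    obtain ⟨v, hv, i, hi, hik, hvi⟩ := hdom
    have hlt : riWeight f < riWeight (Function.update f v i) := by
      refine Finset.card_lt_card (Finset.ssubset_iff_of_subset ?_ |>.2 ⟨v, ?_, ?_⟩)
      · intro u hu
        simp only [Finset.mem_filter, Finset.mem_univ, true_and, Function.update_apply] at hu ⊢
        grind
      · simp; omega
      · simp [hv]
    have hle := riWeight_le_card (Function.update f v i)
    obtain ⟨g, hg, hgf⟩ := exists_isKRiDF_extending G k (Function.update f v i)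
      (by intro u; simp only [Function.update_apply]; grind)
      (by
        intro j hj hjk u w hu hw huw
        have hne := huw.ne
        have hwu := huw.symm
        simp only [Function.update_apply] at hu hw
        grind)
    refine ⟨g, hg, fun u hu => ?_⟩
    have huv : u ≠ v := by rintro rfl; exact hu hv
    have := hgf u
    simp only [Function.update_of_ne huv] at this
    exact this hu
termination_by Fintype.card V - riWeight f

lemma exists_isKRiDF_riWeight_eq (G : SimpleGraph V) (k : ℕ) :
    ∃ f, IsKRiDF G k f ∧ riWeight f = riNumber G k := by
  obtain ⟨g, hg, -⟩ := exists_isKRiDF_extending G k (fun _ => 0)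
    (by simp) (by grind)
  exact Nat.sInf_mem (s := {w | ∃ f, IsKRiDF G k f ∧ riWeight f = w}) ⟨_, g, hg, rfl⟩

lemma IsKRiDF.riNumber_le (hf : IsKRiDF G k f) : riNumber G k ≤ riWeight f :=
  Nat.sInf_le ⟨f, hf, rfl⟩

lemma forall_degree_le_one_iff :
    (∀ v, G.degree v ≤ 1) ↔ ∀ v a b, G.Adj v a → G.Adj v b → a = b := by
  refine forall_congr' fun v => ?_
  rw [← SimpleGraph.card_neighborFinset_eq_degree, Finset.card_le_one]
  simp only [SimpleGraph.mem_neighborFinset]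
  grind

lemma riNumber_two_eq_card_iff (G : SimpleGraph V) :
    riNumber G 2 = Fintype.card V ↔ ∀ v, G.degree v ≤ 1 := by
  rw [forall_degree_le_one_iff]
  constructor
  · intro h v a b hva hvb
    by_contra hab
    obtain ⟨g, hg, hgf⟩ := exists_isKRiDF_extending G 2
      (fun u => if u = a then 1 else if u = b then 2 else 0)
      (by intro u; split_ifs <;> omega)
      (by
        intro i hi hi2 u w hu hw huw
        have hne := huw.ne
        grind)
    have ha : g a = 1 := by simpa using hgf a
    have hb : g b = 2 := by simpa [Ne.symm hab] using hgf b
    have hv := riWeight_eq_card_iff.1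
      (le_antisymm (riWeight_le_card g) (h ▸ hg.riNumber_le)) v
    have h1 := hg.2.1 1 le_rfl (by omega) v a
    have h2 := hg.2.1 2 (by omega) le_rfl v b
    have := hg.1 v
    grind
  · intro h
    obtain ⟨f, hf, hw⟩ := exists_isKRiDF_riWeight_eq G 2
    rw [← hw, riWeight_eq_card_iff]
    intro v hv
    obtain ⟨a, hva, ha⟩ := hf.2.2 v hv 1 le_rfl (by omega)
    obtain ⟨b, hvb, hb⟩ := hf.2.2 v hv 2 (by omega) le_rfl
    grind [h v a b hva hvb]

lemma two_le_riNumber_two (G : SimpleGraph V) (hV : 2 ≤ Fintype.card V) :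
    2 ≤ riNumber G 2 := by
  obtain ⟨f, hf, hw⟩ := exists_isKRiDF_riWeight_eq G 2
  rw [← hw]
  by_cases h0 : ∀ v, f v ≠ 0
  · rwa [riWeight_eq_card_iff.2 h0]
  · push Not at h0
    obtain ⟨v, hv⟩ := h0
    obtain ⟨a, -, ha⟩ := hf.2.2 v hv 1 le_rfl (by omega)
    obtain ⟨b, -, hb⟩ := hf.2.2 v hv 2 (by omega) le_rfl
    exact Finset.one_lt_card.2 ⟨a, by simp [ha], b, by simp [hb], by grind⟩

lemma riNumber_two_le_two {a b : V} (hab : a ≠ b)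
    (h : ∀ w, w ≠ a → w ≠ b → G.Adj w a ∧ G.Adj w b) : riNumber G 2 ≤ 2 := by
  have hf : IsKRiDF G 2 (fun u => if u = a then 1 else if u = b then 2 else 0) := by
    refine ⟨fun u => by dsimp only; split_ifs <;> omega, ?_, ?_⟩
    · intro i hi hi2 u w hu hw huw
      have hne := huw.ne
      grind
    · intro v hv i hi hi2
      obtain rfl | rfl : i = 1 ∨ i = 2 := by omega
      · exact ⟨a, by grind, by simp⟩
      · exact ⟨b, by grind, by simp [hab.symm]⟩
  refine hf.riNumber_le.trans ((Finset.card_le_card (t := {a, b}) ?_).trans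
    Finset.card_le_two)
  intro u hu
  simp only [Finset.mem_filter, Finset.mem_univ, true_and] at hu
  simp only [Finset.mem_insert, Finset.mem_singleton]
  grind

lemma riNumber_compl_two_eq_two (hV : 2 ≤ Fintype.card V) (h : ∀ v, G.degree v ≤ 1) :
    riNumber Gᶜ 2 = 2 := by
  refine le_antisymm ?_ (two_le_riNumber_two _ hV)
  rw [forall_degree_le_one_iff] at h
  by_cases hedge : ∃ a b, G.Adj a b
  · obtain ⟨a, b, hadj⟩ := hedge
    refine riNumber_two_le_two hadj.ne fun w hwa hwb => ?_
    simp only [SimpleGraph.compl_adj]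
    exact ⟨⟨hwa, fun hw => hwb (h a w b hw.symm hadj)⟩,
      ⟨hwb, fun hw => hwa (h b w a hw.symm hadj.symm)⟩⟩
  · push Not at hedge
    obtain ⟨a, b, hab⟩ := Fintype.one_lt_card_iff.1 hV
    refine riNumber_two_le_two hab fun w hwa hwb => ?_
    simp [SimpleGraph.compl_adj, hedge, hwa, hwb]

end RainbowIndependentDomination

theorem stmt_19 {V : Type*} [Fintype V] (G : SimpleGraph V) (n : ℕ)
    (hcard : Fintype.card V = n) :
    (riNumber G 2 = n ↔ ∀ v : V, G.degree v ≤ 1) ∧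
    (3 ≤ n → riNumber G 2 = n → riNumber Gᶜ 2 = 2) := by
  subst hcard
  exact ⟨riNumber_two_eq_card_iff G, fun hn h =>
    riNumber_compl_two_eq_two (by omega) ((riNumber_two_eq_card_iff G).1 h)⟩
end
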